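/- Finite-time risk bound for the slow iterate (Proposition 1(ii)). Suppose the projected two-timescale SA iterates (λ_t, ξ_t) are driven by a Markov process with kernel 𝒦 started at w ∈ 𝒲, that (𝒦, ν, c₁, ρ) satisfies the U_d-geometric-ergodicity bound for d = 1 and for d = 2, that Assumption 2 holds, and that ζ·α₀ > 1 in case κ = 1 and ψ·β₀ > 1 in case δ = 1. Then there exist constants k₁ ≥ 0 and k₂ > 0 (depending on w) and an integer T such that for all t ≥ T: E[‖ξ_t − ξ*‖²] ≤ t^{−δ}·(k₁·ln t + k₂). Moreover, if 𝒦(w') = ν for every w' ∈ 𝒲 (so W₁, W₂, … are i.i.d. with law ν), the constant k₁ can be taken to be 0. -/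

import Mathlib

open MeasureTheory ProbabilityTheory Filter
open scoped RealInnerProductSpace

noncomputable section

/-- Euclidean state space. -/
abbrev Wsp (dW : ℕ) : Type := EuclideanSpace ℝ (Fin dW)

/-- `t`-step iterate of a Markov kernel. -/
noncomputable def kiter {α : Type*} [MeasurableSpace α] (K : Kernel α α) : ℕ → Kernel α α :=
  fun t => Nat.rec (motive := fun _ => Kernel α α) Kernel.id (fun _ ih => ih.comp K) t

instance kiter_isMarkovKernel {α : Type*} [MeasurableSpace α] (K : Kernel α α)
    [IsMarkovKernel K] (t : ℕ) : IsMarkovKernel (kiter K t) := by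
  induction t with
  | zero => exact inferInstanceAs (IsMarkovKernel (Kernel.id))
  | succ n ih => exact inferInstanceAs (IsMarkovKernel ((kiter K n).comp K))

/-- U_d geometric ergodicity bound. -/
def UdBound {dW : ℕ} (K : Kernel (Wsp dW) (Wsp dW)) [IsMarkovKernel K]
    (ν : Measure (Wsp dW)) [IsProbabilityMeasure ν] (c₁ ρ d : ℝ) : Prop :=
  Integrable (fun w' => (1 : ℝ) + ‖w'‖ ^ d) ν ∧
  ∀ (t : ℕ) (w : Wsp dW) (f : Wsp dW → ℝ), Measurable f →
    (∀ w', |f w'| ≤ 1 + ‖w'‖ ^ d) →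
      (∫ w', |f w'|
          ∂((((kiter K t) w).toSignedMeasure - ν.toSignedMeasure).totalVariation))
        ≤ c₁ * ρ ^ t * (1 + ‖w‖ ^ d)

/-- Markov process with kernel `K` started at `w`. -/
structure IsMarkovProc {dW : ℕ} {Ω : Type*} [MeasurableSpace Ω]
    (K : Kernel (Wsp dW) (Wsp dW)) (P : Measure Ω)
    (Wp : ℕ → Ω → Wsp dW) (w : Wsp dW) : Prop where
  meas : ∀ t, Measurable (Wp t)
  init : ∀ᵐ ω ∂P, Wp 0 ω = w
  markov : ∀ (t : ℕ) (f : Wsp dW → ℝ), Measurable f → (∃ C, ∀ x, |f x| ≤ C) →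
    (P[(fun ω => f (Wp (t+1) ω)) |
        ⨆ s ∈ Finset.range (t+1), MeasurableSpace.comap (Wp s) inferInstance])
      =ᵐ[P] fun ω => ∫ x, f x ∂(K (Wp t ω))

/-- Metric projection onto the closed ball of radius `B` centered at the origin. -/
def projB {E : Type*} [NormedAddCommGroup E] [NormedSpace ℝ E] (B : ℝ) (x : E) : E :=
  if ‖x‖ ≤ B then x else (B / ‖x‖) • x

/-- The slow (first-stage) SA iterates. -/
def xiSeq {dW dX : ℕ} {Ω : Type*}
    (H : Wsp dW → EuclideanSpace ℝ (Fin dX) → EuclideanSpace ℝ (Fin dX))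
    (β : ℕ → ℝ) (B : ℝ) (Wp : ℕ → Ω → Wsp dW) (xi0 : EuclideanSpace ℝ (Fin dX)) :
    ℕ → Ω → EuclideanSpace ℝ (Fin dX) :=
  fun t => Nat.rec (motive := fun _ => Ω → EuclideanSpace ℝ (Fin dX)) (fun _ => xi0)
    (fun s ih => fun ω => projB B (ih ω + β s • H (Wp s ω) (ih ω))) t

/-- The fast SA iterates. -/
def lamSeq {dW dL dX : ℕ} {Ω : Type*}
    (G : Wsp dW → EuclideanSpace ℝ (Fin dL) → EuclideanSpace ℝ (Fin dX) →
      EuclideanSpace ℝ (Fin dL))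
    (H : Wsp dW → EuclideanSpace ℝ (Fin dX) → EuclideanSpace ℝ (Fin dX))
    (α β : ℕ → ℝ) (B : ℝ) (Wp : ℕ → Ω → Wsp dW)
    (lam0 : EuclideanSpace ℝ (Fin dL)) (xi0 : EuclideanSpace ℝ (Fin dX)) :
    ℕ → Ω → EuclideanSpace ℝ (Fin dL) :=
  fun t => Nat.rec (motive := fun _ => Ω → EuclideanSpace ℝ (Fin dL)) (fun _ => lam0)
    (fun s ih => fun ω =>
      projB B (ih ω + α s • G (Wp s ω) (ih ω) (xiSeq H β B Wp xi0 s ω))) t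

/-- Assumption 2. -/
structure Assumption2 {dW dL dX : ℕ}
    (ν : Measure (Wsp dW))
    (G : Wsp dW → EuclideanSpace ℝ (Fin dL) → EuclideanSpace ℝ (Fin dX) →
      EuclideanSpace ℝ (Fin dL))
    (H : Wsp dW → EuclideanSpace ℝ (Fin dX) → EuclideanSpace ℝ (Fin dX))
    (lamStar : EuclideanSpace ℝ (Fin dL)) (xiStar : EuclideanSpace ℝ (Fin dX))
    (B L ζ ψ : ℝ) : Prop where
  hGmeas : Measurable fun p : Wsp dW × EuclideanSpace ℝ (Fin dL) × EuclideanSpace ℝ (Fin dX) =>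
    G p.1 p.2.1 p.2.2
  hHmeas : Measurable fun p : Wsp dW × EuclideanSpace ℝ (Fin dX) => H p.1 p.2
  hHstar : (∫ w', H w' xiStar ∂ν) = 0
  hHuniq : ∀ ξ, (∫ w', H w' ξ ∂ν) = 0 → ξ = xiStar
  hGstar : (∫ w', G w' lamStar xiStar ∂ν) = 0
  hGuniq : ∀ lam, (∫ w', G w' lam xiStar ∂ν) = 0 → lam = lamStar
  hB : max ‖lamStar‖ ‖xiStar‖ < B
  hL : 0 < L
  hGLip : ∀ (w' : Wsp dW) lam lam' ξ ξ', ‖lam‖ ≤ B → ‖lam'‖ ≤ B → ‖ξ‖ ≤ B → ‖ξ'‖ ≤ B →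
    ‖G w' lam ξ - G w' lam' ξ'‖ ≤ L * (1 + ‖w'‖) * (‖lam - lam'‖ + ‖ξ - ξ'‖)
  hHLip : ∀ (w' : Wsp dW) ξ ξ', ‖ξ‖ ≤ B → ‖ξ'‖ ≤ B →
    ‖H w' ξ - H w' ξ'‖ ≤ L * (1 + ‖w'‖) * ‖ξ - ξ'‖
  hGgrow : ∀ (w' : Wsp dW) lam ξ, ‖lam‖ ≤ B → ‖ξ‖ ≤ B → ‖G w' lam ξ‖ ≤ L * (1 + ‖w'‖)
  hHgrow : ∀ (w' : Wsp dW) ξ, ‖ξ‖ ≤ B → ‖H w' ξ‖ ≤ L * (1 + ‖w'‖)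
  hζ : 0 < ζ
  hGmono : ∀ lam, ⟪lam - lamStar,
      (∫ w', G w' lam xiStar ∂ν) - (∫ w', G w' lamStar xiStar ∂ν)⟫
      ≤ -ζ * ‖lam - lamStar‖ ^ 2
  hψ : 0 < ψ
  hHmono : ∀ ξ, ⟪ξ - xiStar, (∫ w', H w' ξ ∂ν) - (∫ w', H w' xiStar ∂ν)⟫
      ≤ -ψ * ‖ξ - xiStar‖ ^ 2

/-- Step sizes `t ^ (-δ)` with `δ ≤ 1` decrease at relative rate at most `1 / t`. -/
lemma rpow_neg_mul_one_sub_inv_le {δ : ℝ} (hδ1 : δ ≤ 1) {t : ℝ} (ht : 0 < t) :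
    t ^ (-δ) * (1 - t⁻¹) ≤ (t + 1) ^ (-δ) := by
  have h1 : t / (t + 1) ≤ (t / (t + 1)) ^ δ := by
    have := Real.rpow_le_rpow_of_exponent_ge (x := t / (t + 1)) (by positivity)
      (by rw [div_le_one (by positivity)]; linarith) hδ1
    simpa using this
  have h2 : (t + 1) ^ (-δ) = t ^ (-δ) * (t / (t + 1)) ^ δ := by
    rw [Real.div_rpow ht.le (by positivity), Real.rpow_neg ht.le, Real.rpow_neg (by positivity)]
    have := (Real.rpow_pos_of_pos ht δ).ne'
    field_simp
  rw [h2]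
  refine mul_le_mul_of_nonneg_left (le_trans ?_ h1) (by positivity)
  rw [sub_le_iff_le_add, div_add' _ _ _ (by positivity), one_le_div (by positivity), mul_add,
    inv_mul_cancel₀ ht.ne']
  linarith [inv_pos.2 ht]

/-- Eventually `t ^ (δ - 1)` stays strictly below `c`, where `c > 1` is required if `δ = 1`. -/
lemma exists_eventually_rpow_sub_one_le {δ c : ℝ} (hδ1 : δ ≤ 1) (hc : 0 < c)
    (hone : δ = 1 → 1 < c) :
    ∃ η > 0, ∀ᶠ t : ℕ in atTop, (t : ℝ) ^ (δ - 1) ≤ c - η := by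
  rcases hδ1.eq_or_lt with rfl | h
  · exact ⟨c - 1, by linarith [hone rfl], .of_forall fun t => by simp⟩
  · refine ⟨c / 2, by positivity, ?_⟩
    have h2 : Tendsto (fun t : ℕ => (t : ℝ) ^ (-(1 - δ))) atTop (nhds 0) :=
      (tendsto_rpow_neg_atTop (by linarith)).comp tendsto_natCast_atTop_atTop
    filter_upwards [h2.eventually_le_const (by linarith : 0 < c - c / 2)] with t ht
    simpa using ht

/-- A Chung-type lemma: sequences satisfying a recursion with contraction factor
`1 - c * t ^ (-δ)` and perturbation of order `t ^ (-2 * δ)` are of order `t ^ (-δ)`. -/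
lemma exists_le_rpow_neg_of_recursion {δ c C : ℝ} (hδ0 : 0 < δ) (hδ1 : δ ≤ 1) (hc : 0 < c)
    (hone : δ = 1 → 1 < c) {y : ℕ → ℝ}
    (hy : ∀ᶠ t : ℕ in atTop, y (t + 1) ≤ (1 - c * (t : ℝ) ^ (-δ)) * y t
      + C * ((t : ℝ) ^ (-δ)) ^ 2) :
    ∃ D, 0 ≤ D ∧ ∀ᶠ t : ℕ in atTop, y t ≤ D * (t : ℝ) ^ (-δ) := by
  obtain ⟨η, hη, hev⟩ := exists_eventually_rpow_sub_one_le hδ1 hc hone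
  have hsmall : ∀ᶠ t : ℕ in atTop, c * (t : ℝ) ^ (-δ) ≤ 1 := by
    have h2 : Tendsto (fun t : ℕ => c * (t : ℝ) ^ (-δ)) atTop (nhds (c * 0)) :=
      ((tendsto_rpow_neg_atTop hδ0).comp tendsto_natCast_atTop_atTop).const_mul c
    rw [mul_zero] at h2
    exact h2.eventually_le_const one_pos
  obtain ⟨T, hT⟩ := eventually_atTop.1 (hy.and (hev.and (hsmall.and (eventually_ge_atTop 1))))
  refine ⟨max (max (C / η) (y T * (T : ℝ) ^ δ)) 0, le_max_right _ _,
    eventually_atTop.2 ⟨T, fun t ht => ?_⟩⟩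
  set D := max (max (C / η) (y T * (T : ℝ) ^ δ)) 0
  have hD : 0 ≤ D := le_max_right _ _
  induction t, ht using Nat.le_induction with
  | base =>
    have hT1 : (0 : ℝ) < T := by exact_mod_cast (hT T le_rfl).2.2.2
    calc y T = y T * (T : ℝ) ^ δ * (T : ℝ) ^ (-δ) := by
          rw [mul_assoc, ← Real.rpow_add hT1]; simp
      _ ≤ _ := mul_le_mul_of_nonneg_right ((le_max_right _ _).trans (le_max_left _ _))
        (by positivity)
  | succ t ht ih =>
    obtain ⟨h1, h2, h3, h4⟩ := hT t ht
    have ht0 : (0 : ℝ) < t := by exact_mod_cast h4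
    have hDC : C ≤ D * η := (div_le_iff₀ hη).1 ((le_max_left _ _).trans (le_max_left _ _))
    set b : ℝ := (t : ℝ) ^ (-δ) with hb
    have hb0 : 0 < b := by positivity
    have hinv : (t : ℝ)⁻¹ = b * (t : ℝ) ^ (δ - 1) := by
      rw [hb, ← Real.rpow_add ht0, ← Real.rpow_neg_one]; congr 1; ring
    have hstep := rpow_neg_mul_one_sub_inv_le hδ1 ht0
    rw [← hb, hinv] at hstep
    calc y (t + 1) ≤ (1 - c * b) * (D * b) + C * b ^ 2 :=
            h1.trans (by gcongr)
        _ ≤ (1 - c * b) * (D * b) + D * (c - (t : ℝ) ^ (δ - 1)) * b ^ 2 := by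
            gcongr
            exact hDC.trans (mul_le_mul_of_nonneg_left (by linarith) hD)
        _ = D * (b * (1 - b * (t : ℝ) ^ (δ - 1))) := by ring
        _ ≤ D * ((t : ℝ) + 1) ^ (-δ) := by gcongr
        _ = _ := by push_cast; rfl

lemma norm_projB_le {E : Type*} [NormedAddCommGroup E] [NormedSpace ℝ E] {B : ℝ} (hB : 0 ≤ B)
    (x : E) : ‖projB B x‖ ≤ B := by
  unfold projB
  split_ifs with h
  · exact h
  · have hx : 0 < ‖x‖ := hB.trans_lt (not_le.1 h)
    rw [norm_smul, norm_div, norm_norm, Real.norm_of_nonneg hB, div_mul_cancel₀ _ hx.ne']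

lemma projB_of_norm_le {E : Type*} [NormedAddCommGroup E] [NormedSpace ℝ E] {B : ℝ} {x : E}
    (h : ‖x‖ ≤ B) : projB B x = x := if_pos h

lemma norm_projB_sub_le {E : Type*} [NormedAddCommGroup E] [InnerProductSpace ℝ E] {B : ℝ}
    {y : E} (hy : ‖y‖ ≤ B) (x : E) : ‖projB B x - y‖ ≤ ‖x - y‖ := by
  unfold projB
  split_ifs with h
  · rfl
  · have h := not_le.1 h
    have hB : 0 ≤ B := (norm_nonneg y).trans hy
    have hx : 0 < ‖x‖ := hB.trans_lt h
    set s := B / ‖x‖ with hs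
    have hsB : s * ‖x‖ = B := div_mul_cancel₀ _ hx.ne'
    have hs1 : s ≤ 1 := (div_le_one hx).2 h.le
    have hxy : inner ℝ x y ≤ ‖x‖ * B :=
      (real_inner_le_norm x y).trans (by gcongr)
    refine le_of_sq_le_sq ?_ (norm_nonneg _)
    rw [@norm_sub_sq_real, @norm_sub_sq_real, norm_smul, Real.norm_of_nonneg (by positivity),
      real_inner_smul_left, hsB]
    nlinarith [mul_le_mul_of_nonneg_left hxy (sub_nonneg.2 hs1), sq_nonneg (‖x‖ - B)]

lemma measurable_projB {E : Type*} [NormedAddCommGroup E] [NormedSpace ℝ E] [MeasurableSpace E]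
    [BorelSpace E] [SecondCountableTopology E] (B : ℝ) : Measurable (projB (E := E) B) := by
  unfold projB
  exact Measurable.ite (measurableSet_le measurable_norm measurable_const) measurable_id
    (by fun_prop)

/-- The difference of two integrals is controlled by the total variation of the difference. -/
lemma abs_integral_sub_integral_le_totalVariation {α : Type*} [MeasurableSpace α]
    (μ ν : Measure α) [IsFiniteMeasure μ] [IsFiniteMeasure ν] {g : α → ℝ} (hg : Measurable g)
    {M : ℝ} (hM : ∀ x, |g x| ≤ M) :
    |∫ x, g x ∂μ - ∫ x, g x ∂ν|
      ≤ ∫ x, |g x| ∂((μ.toSignedMeasure - ν.toSignedMeasure).totalVariation) := by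
  set j := (μ.toSignedMeasure - ν.toSignedMeasure).toJordanDecomposition with hj
  have hint : ∀ (m : Measure α) [IsFiniteMeasure m], Integrable g m := fun m _ =>
    .of_bound hg.aestronglyMeasurable M (.of_forall hM)
  have hsum : μ + j.negPart = ν + j.posPart := by
    rw [← Measure.toSignedMeasure_eq_toSignedMeasure_iff, Measure.toSignedMeasure_add,
      Measure.toSignedMeasure_add]
    have h : j.posPart.toSignedMeasure - j.negPart.toSignedMeasure
        = μ.toSignedMeasure - ν.toSignedMeasure :=
      SignedMeasure.toSignedMeasure_toJordanDecomposition _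
    rw [← sub_eq_zero] at h ⊢
    rw [← neg_eq_zero, ← h]
    abel
  have hI := congrArg (fun m => ∫ x, g x ∂m) hsum
  simp only [integral_add_measure (hint _) (hint _)] at hI
  have hdiff : ∫ x, g x ∂μ - ∫ x, g x ∂ν = ∫ x, g x ∂j.posPart - ∫ x, g x ∂j.negPart := by
    linarith
  rw [hdiff, SignedMeasure.totalVariation, ← hj,
    integral_add_measure (hint _).abs (hint _).abs]
  exact (abs_sub _ _).trans (add_le_add (abs_integral_le_integral_abs)
    (abs_integral_le_integral_abs))

lemma comp_kiter {α : Type*} [MeasurableSpace α] (K : Kernel α α) (t : ℕ) :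
    K.comp (kiter K t) = kiter K (t + 1) := by
  induction t with
  | zero => exact (Kernel.comp_id K).trans (Kernel.id_comp K).symm
  | succ t ih =>
    change K.comp ((kiter K t).comp K) = (kiter K (t + 1)).comp K
    rw [← Kernel.comp_assoc, ih]

/-- Truncation of `g` at levels `± n`. -/
lemma abs_max_neg_min_le (a : ℝ) (n : ℕ) :
    |max (-(n : ℝ)) (min a n)| ≤ |a| ∧ |max (-(n : ℝ)) (min a n)| ≤ n := by
  have hn : (0 : ℝ) ≤ n := n.cast_nonneg
  have h1 := neg_abs_le a
  have h2 := le_abs_self a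
  have h3 := abs_nonneg a
  refine ⟨abs_le.2 ⟨?_, ?_⟩, abs_le.2 ⟨?_, ?_⟩⟩ <;> grind

lemma tendsto_max_neg_min (a : ℝ) :
    Tendsto (fun n : ℕ => max (-(n : ℝ)) (min a n)) atTop (nhds a) := by
  obtain ⟨N, hN⟩ := exists_nat_ge |a|
  refine tendsto_const_nhds.congr' ?_
  filter_upwards [eventually_ge_atTop N] with n hn
  have hn' : |a| ≤ n := hN.trans (by exact_mod_cast hn)
  rw [abs_le] at hn'
  rw [min_eq_left hn'.2, max_eq_right hn'.1]

section WeightedTotalVariation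

variable {α : Type*} [MeasurableSpace α] {μ ν : Measure α} {V : α → ℝ} {b : ℝ}

/-- If bounded functions dominated by `V` have `μ`- and `ν`-integrals within `b` of each other and
`V` is `ν`-integrable, then `V` is `μ`-integrable. -/
lemma integrable_of_abs_integral_sub_le [IsFiniteMeasure μ]
    (hV : Measurable V) (hV0 : ∀ x, 0 ≤ V x) (hVν : Integrable V ν)
    (h : ∀ g : α → ℝ, Measurable g → (∃ M, ∀ x, |g x| ≤ M) → (∀ x, |g x| ≤ V x) →
      |∫ x, g x ∂μ - ∫ x, g x ∂ν| ≤ b) : Integrable V μ := by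
  set g : ℕ → α → ℝ := fun n x => max (-(n : ℝ)) (min (V x) n) with hg
  have hgm : ∀ n, Measurable (g n) := fun n => by fun_prop
  have hgV : ∀ n x, |g n x| ≤ V x := fun n x =>
    (abs_max_neg_min_le (V x) n).1.trans_eq (abs_of_nonneg (hV0 x))
  have hg0 : ∀ n x, 0 ≤ g n x := fun n x => le_max_of_le_right (le_min (hV0 x) n.cast_nonneg)
  have hgb : ∀ n x, |g n x| ≤ n := fun n x => (abs_max_neg_min_le (V x) n).2
  refine ⟨hV.aestronglyMeasurable, lt_of_le_of_lt ?_
    (ENNReal.ofReal_lt_top (r := ∫ x, V x ∂ν + b))⟩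
  have hlim : ∫⁻ x, ‖V x‖ₑ ∂μ ≤ liminf (fun n => ∫⁻ x, ‖g n x‖ₑ ∂μ) atTop := by
    rw [← lintegral_congr fun x => (tendsto_max_neg_min (V x)).enorm.liminf_eq]
    exact lintegral_liminf_le fun n => (hgm n).enorm
  refine hlim.trans (liminf_le_of_frequently_le' (Frequently.of_forall fun n => ?_))
  have hint : Integrable (g n) μ := .of_bound (hgm n).aestronglyMeasurable n (.of_forall (hgb n))
  have hintν : Integrable (g n) ν := hVν.mono' (hgm n).aestronglyMeasurable (.of_forall (hgV n))
  simp_rw [← ofReal_norm, Real.norm_of_nonneg (hg0 n _)]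
  rw [← ofReal_integral_eq_lintegral_ofReal hint (.of_forall (hg0 n))]
  refine ENNReal.ofReal_le_ofReal ?_
  have h1 := (abs_le.1 (h (g n) (hgm n) ⟨n, hgb n⟩ (hgV n))).2
  have h2 : ∫ x, g n x ∂ν ≤ ∫ x, V x ∂ν :=
    integral_mono hintν hVν fun x => (le_abs_self _).trans (hgV n x)
  linarith

/-- A weighted total variation bound on bounded functions extends to all functions dominated by
the weight. -/
lemma abs_integral_sub_le_of_bounded (hVμ : Integrable V μ) (hVν : Integrable V ν)
    (h : ∀ g : α → ℝ, Measurable g → (∃ M, ∀ x, |g x| ≤ M) → (∀ x, |g x| ≤ V x) →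
      |∫ x, g x ∂μ - ∫ x, g x ∂ν| ≤ b)
    {f : α → ℝ} (hf : Measurable f) (hfV : ∀ x, |f x| ≤ V x) :
    |∫ x, f x ∂μ - ∫ x, f x ∂ν| ≤ b := by
  set g : ℕ → α → ℝ := fun n x => max (-(n : ℝ)) (min (f x) n) with hg
  have hgm : ∀ n, Measurable (g n) := fun n => by fun_prop
  have hgV : ∀ n x, |g n x| ≤ V x := fun n x => (abs_max_neg_min_le (f x) n).1.trans (hfV x)
  have hlim : ∀ {m : Measure α}, Integrable V m →
      Tendsto (fun n => ∫ x, g n x ∂m) atTop (nhds (∫ x, f x ∂m)) := fun hVm =>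
    tendsto_integral_of_dominated_convergence V (fun n => (hgm n).aestronglyMeasurable) hVm
      (fun n => .of_forall (hgV n)) (.of_forall fun x => tendsto_max_neg_min _)
  exact le_of_tendsto ((hlim hVμ).sub (hlim hVν)).abs (.of_forall fun n =>
    h (g n) (hgm n) ⟨n, fun x => (abs_max_neg_min_le (f x) n).2⟩ (hgV n))

end WeightedTotalVariation

namespace UdBound

variable {dW : ℕ} {K : Kernel (Wsp dW) (Wsp dW)} [IsMarkovKernel K] {ν : Measure (Wsp dW)}
  [IsProbabilityMeasure ν] {c₁ ρ d : ℝ}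

lemma abs_integral_sub_le_of_bounded (hU : UdBound K ν c₁ ρ d) (t : ℕ) (w : Wsp dW)
    (g : Wsp dW → ℝ) (hg : Measurable g) (hM : ∃ M, ∀ x, |g x| ≤ M)
    (hgV : ∀ x, |g x| ≤ 1 + ‖x‖ ^ d) :
    |∫ x, g x ∂(kiter K t w) - ∫ x, g x ∂ν| ≤ c₁ * ρ ^ t * (1 + ‖w‖ ^ d) :=
  (abs_integral_sub_integral_le_totalVariation _ _ hg hM.choose_spec).trans
    (hU.2 t w g hg hgV)

lemma integrable_kiter (hU : UdBound K ν c₁ ρ d) (t : ℕ) (w : Wsp dW) :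
    Integrable (fun x => 1 + ‖x‖ ^ d) (kiter K t w) :=
  integrable_of_abs_integral_sub_le (by fun_prop) (fun x => by positivity) hU.1
    (hU.abs_integral_sub_le_of_bounded t w)

lemma abs_integral_sub_le (hU : UdBound K ν c₁ ρ d) (t : ℕ) (w : Wsp dW)
    {f : Wsp dW → ℝ} (hf : Measurable f) (hfV : ∀ x, |f x| ≤ 1 + ‖x‖ ^ d) :
    |∫ x, f x ∂(kiter K t w) - ∫ x, f x ∂ν| ≤ c₁ * ρ ^ t * (1 + ‖w‖ ^ d) :=
  _root_.abs_integral_sub_le_of_bounded (hU.integrable_kiter t w) hU.1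
    (hU.abs_integral_sub_le_of_bounded t w) hf hfV

end UdBound

/-- The solution `∑ n, Kⁿ g` of the Poisson equation `u - K u = g`. -/
def poissonSol {α : Type*} [MeasurableSpace α] (K : Kernel α α) (g : α → ℝ) (w : α) : ℝ :=
  ∑' n, ∫ x, g x ∂(kiter K n w)

namespace UdBound

variable {dW : ℕ} {K : Kernel (Wsp dW) (Wsp dW)} [IsMarkovKernel K] {ν : Measure (Wsp dW)}
  [IsProbabilityMeasure ν] {c₁ ρ d C : ℝ} {g h : Wsp dW → ℝ}

lemma integrable_of_abs_le (hU : UdBound K ν c₁ ρ d) (hg : Measurable g)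
    (hgV : ∀ x, |g x| ≤ C * (1 + ‖x‖ ^ d)) (n : ℕ) (w : Wsp dW) :
    Integrable g (kiter K n w) :=
  ((hU.integrable_kiter n w).const_mul C).mono' hg.aestronglyMeasurable (.of_forall hgV)

lemma abs_integral_kiter_le (hU : UdBound K ν c₁ ρ d) (hC : 0 ≤ C) (hg : Measurable g)
    (hgV : ∀ x, |g x| ≤ C * (1 + ‖x‖ ^ d)) (hgν : ∫ x, g x ∂ν = 0) (n : ℕ) (w : Wsp dW) :
    |∫ x, g x ∂(kiter K n w)| ≤ C * c₁ * (1 + ‖w‖ ^ d) * ρ ^ n := by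
  rcases hC.eq_or_lt with rfl | hC
  · have : ∀ x, g x = 0 := fun x => abs_nonpos_iff.1 (by simpa using hgV x)
    simp [this]
  · have h := hU.abs_integral_sub_le n w (f := fun x => C⁻¹ * g x) (by fun_prop) fun x => by
      rw [abs_mul, abs_of_pos (inv_pos.2 hC), inv_mul_le_iff₀ hC]
      exact hgV x
    rw [integral_const_mul, integral_const_mul, hgν, mul_zero, sub_zero, abs_mul,
      abs_of_pos (inv_pos.2 hC), inv_mul_le_iff₀ hC] at h
    exact h.trans_eq (by ring)

lemma hasSum_poissonSol (hU : UdBound K ν c₁ ρ d) (hρ₀ : 0 ≤ ρ) (hρ₁ : ρ < 1) (hC : 0 ≤ C)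
    (hg : Measurable g) (hgV : ∀ x, |g x| ≤ C * (1 + ‖x‖ ^ d)) (hgν : ∫ x, g x ∂ν = 0)
    (w : Wsp dW) : HasSum (fun n => ∫ x, g x ∂(kiter K n w)) (poissonSol K g w) :=
  (Summable.of_norm_bounded ((summable_geometric_of_lt_one hρ₀ hρ₁).mul_left _)
    fun n => hU.abs_integral_kiter_le hC hg hgV hgν n w).hasSum

lemma abs_poissonSol_le (hU : UdBound K ν c₁ ρ d) (hρ₀ : 0 ≤ ρ) (hρ₁ : ρ < 1) (hC : 0 ≤ C)
    (hg : Measurable g) (hgV : ∀ x, |g x| ≤ C * (1 + ‖x‖ ^ d)) (hgν : ∫ x, g x ∂ν = 0)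
    (w : Wsp dW) : |poissonSol K g w| ≤ C * (c₁ * (1 - ρ)⁻¹) * (1 + ‖w‖ ^ d) := by
  have h := tsum_of_norm_bounded (f := fun n => ∫ x, g x ∂(kiter K n w))
    ((hasSum_geometric_of_lt_one hρ₀ hρ₁).mul_left _)
    fun n => hU.abs_integral_kiter_le hC hg hgV hgν n w
  exact h.trans_eq (by ring)

lemma poissonSol_sub (hU : UdBound K ν c₁ ρ d) (hρ₀ : 0 ≤ ρ) (hρ₁ : ρ < 1) (hC : 0 ≤ C)
    (hg : Measurable g) (hgV : ∀ x, |g x| ≤ C * (1 + ‖x‖ ^ d)) (hgν : ∫ x, g x ∂ν = 0)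
    (hh : Measurable h) (hhV : ∀ x, |h x| ≤ C * (1 + ‖x‖ ^ d)) (hhν : ∫ x, h x ∂ν = 0)
    (w : Wsp dW) :
    poissonSol K (fun x => g x - h x) w = poissonSol K g w - poissonSol K h w := by
  rw [← ((hU.hasSum_poissonSol hρ₀ hρ₁ hC hg hgV hgν w).sub
    (hU.hasSum_poissonSol hρ₀ hρ₁ hC hh hhV hhν w)).tsum_eq]
  exact tsum_congr fun n =>
    integral_sub (hU.integrable_of_abs_le hg hgV n w) (hU.integrable_of_abs_le hh hhV n w)

lemma poissonSol_eq_add (hU : UdBound K ν c₁ ρ d) (hρ₀ : 0 ≤ ρ) (hρ₁ : ρ < 1) (hC : 0 ≤ C)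
    (hg : Measurable g) (hgV : ∀ x, |g x| ≤ C * (1 + ‖x‖ ^ d)) (hgν : ∫ x, g x ∂ν = 0)
    (w : Wsp dW) : poissonSol K g w = g w + ∫ x, poissonSol K g x ∂(K w) := by
  have hK : kiter K 1 = K := Kernel.id_comp K
  have hterm : ∀ n, ∫ x, g x ∂(kiter K (n + 1) w) = ∫ y, ∫ x, g x ∂(kiter K n y) ∂(K w) :=
    fun n => Kernel.integral_comp (hU.integrable_of_abs_le hg hgV (n + 1) w)
  have hbd := fun n y => hU.abs_integral_kiter_le hC hg hgV hgν n y
  have hVK : Integrable (fun x => 1 + ‖x‖ ^ d) (K w) := hK ▸ hU.integrable_kiter 1 w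
  have hgeo := summable_geometric_of_lt_one hρ₀ hρ₁
  have hsum := hasSum_integral_of_dominated_convergence (μ := K w)
    (F := fun n y => ∫ x, g x ∂(kiter K n y)) (f := poissonSol K g)
    (fun n y => C * c₁ * (1 + ‖y‖ ^ d) * ρ ^ n)
    (fun n => hg.stronglyMeasurable.integral_kernel.aestronglyMeasurable)
    (fun n => .of_forall (hbd n)) (.of_forall fun y => hgeo.mul_left _)
    (by simp_rw [tsum_mul_left]; exact (hVK.const_mul _).mul_const _)
    (.of_forall fun y => hU.hasSum_poissonSol hρ₀ hρ₁ hC hg hgV hgν y)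
  have h0 : ∫ x, g x ∂(kiter K 0 w) = g w := by
    change ∫ x, g x ∂(Kernel.id w) = g w
    rw [Kernel.id_apply, integral_dirac]
  rw [← hsum.tsum_eq, poissonSol,
    (hU.hasSum_poissonSol hρ₀ hρ₁ hC hg hgV hgν w).summable.tsum_eq_zero_add, h0]
  simp_rw [hterm]

lemma measurable_poissonSol {S : Type*} [MeasurableSpace S] {f : Wsp dW → S → ℝ}
    (hU : UdBound K ν c₁ ρ d) (hρ₀ : 0 ≤ ρ) (hρ₁ : ρ < 1) (hC : 0 ≤ C)
    (hf : Measurable (Function.uncurry f)) (hfV : ∀ s x, |f x s| ≤ C * (1 + ‖x‖ ^ d))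
    (hfν : ∀ s, ∫ x, f x s ∂ν = 0) :
    Measurable fun p : S × Wsp dW => poissonSol K (fun x => f x p.1) p.2 := by
  refine measurable_of_tendsto_metrizable (f := fun N (p : S × Wsp dW) =>
    ∑ n ∈ Finset.range N, ∫ x, f x p.1 ∂(kiter K n p.2)) (fun N => ?_)
    (tendsto_pi_nhds.2 fun p => (hU.hasSum_poissonSol hρ₀ hρ₁ hC (by fun_prop) (hfV p.1)
      (hfν p.1) p.2).tendsto_sum_nat)
  refine Finset.measurable_fun_sum _ fun n _ => ?_
  have h : StronglyMeasurable
      (Function.uncurry fun (p : S × Wsp dW) (x : Wsp dW) => f x p.1) :=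
    (hf.comp (by fun_prop : Measurable fun q : (S × Wsp dW) × Wsp dW =>
      (q.2, q.1.1))).stronglyMeasurable
  exact (h.integral_kernel_prod_right
    (κ := (kiter K n).comap (Prod.snd : S × Wsp dW → _) measurable_snd)).measurable

end UdBound

/-- If the conditional law of `Y` given `m` is `κ (Z ·)` with `Z` measurable with respect to `m`,
then the joint law of `(Z, Y)` is the composition-product of the law of `Z` and `κ`. -/
lemma map_prodMk_eq_compProd_of_condExp {Ω S T : Type*} {m mΩ : MeasurableSpace Ω}
    [MeasurableSpace S] [MeasurableSpace T] {P : Measure Ω} [IsProbabilityMeasure P]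
    {Z : Ω → S} {Y : Ω → T} {κ : Kernel S T} [IsMarkovKernel κ] (hm : m ≤ mΩ)
    (hZ : Measurable[m] Z) (hY : Measurable Y)
    (h : ∀ f : T → ℝ, Measurable f → (∃ C, ∀ x, |f x| ≤ C) →
      P[fun ω => f (Y ω) | m] =ᵐ[P] fun ω => ∫ x, f x ∂(κ (Z ω))) :
    P.map (fun ω => (Z ω, Y ω)) = (P.map Z) ⊗ₘ κ := by
  have hZ' : Measurable Z := hZ.mono hm le_rfl
  have := Measure.isProbabilityMeasure_map (μ := P) hZ'.aemeasurable
  have := Measure.isProbabilityMeasure_map (μ := P) (hZ'.prodMk hY).aemeasurable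
  refine Measure.ext_prod fun {s t} hs ht => ?_
  rw [Measure.map_apply (hZ'.prodMk hY) (hs.prod ht), Measure.compProd_apply_prod hs ht,
    setLIntegral_map hs (κ.measurable_coe ht) hZ']
  have hind : ∀ x, |t.indicator (fun _ => (1 : ℝ)) x| ≤ 1 := fun x => by
    by_cases hx : x ∈ t <;> simp [hx]
  have hmeas : Measurable (t.indicator fun _ => (1 : ℝ)) := measurable_const.indicator ht
  have hint : Integrable (fun ω => t.indicator (fun _ => (1 : ℝ)) (Y ω)) P :=
    .of_bound (hmeas.comp hY).aestronglyMeasurable 1 (.of_forall fun ω => hind (Y ω))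
  have hset := setIntegral_condExp hm hint (hZ hs)
  rw [setIntegral_congr_ae (hZ' hs) ((h _ hmeas ⟨1, hind⟩).mono fun ω hω _ => hω)] at hset
  simp only [integral_indicator_const (1 : ℝ) ht, smul_eq_mul, mul_one] at hset
  have hR : ∫ ω in Z ⁻¹' s, t.indicator (fun _ => (1 : ℝ)) (Y ω) ∂P
      = P.real ((Z ⁻¹' s) ∩ (Y ⁻¹' t)) := by
    have : (fun ω => t.indicator (fun _ => (1 : ℝ)) (Y ω))
        = (Y ⁻¹' t).indicator fun _ => (1 : ℝ) := rfl
    rw [this, integral_indicator_const (1 : ℝ) (hY ht), measureReal_restrict_apply (hY ht),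
      smul_eq_mul, mul_one, Set.inter_comm]
  rw [hR] at hset
  have hL : ∫⁻ ω in Z ⁻¹' s, κ (Z ω) t ∂P
      = ENNReal.ofReal (∫ ω in Z ⁻¹' s, (κ (Z ω)).real t ∂P) := by
    have hb : Measurable fun ω => (κ (Z ω)).real t :=
      ((κ.measurable_coe ht).comp hZ').ennreal_toReal
    rw [ofReal_integral_eq_lintegral_ofReal
      (.of_bound hb.aestronglyMeasurable 1 (.of_forall fun ω => by
        rw [Real.norm_of_nonneg measureReal_nonneg]; exact measureReal_le_one))
      (.of_forall fun ω => measureReal_nonneg)]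
    exact lintegral_congr fun ω => (ofReal_measureReal (μ := κ (Z ω))).symm
  rw [hL, hset, ofReal_measureReal]
  rfl

namespace IsMarkovProc

variable {dW : ℕ} {Ω : Type*} [MeasurableSpace Ω] {K : Kernel (Wsp dW) (Wsp dW)}
  {P : Measure Ω} {Wp : ℕ → Ω → Wsp dW} {w : Wsp dW}

lemma iSup_comap_le (h : IsMarkovProc K P Wp w) (t : ℕ) :
    (⨆ s ∈ Finset.range t, MeasurableSpace.comap (Wp s) inferInstance) ≤ ‹MeasurableSpace Ω› :=
  iSup₂_le fun s _ => (h.meas s).comap_le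

variable [IsMarkovKernel K] [IsProbabilityMeasure P]

/-- Joint law of the history up to time `t` and of the state at time `t + 1`. -/
lemma map_prodMk {S : Type*} [MeasurableSpace S] (h : IsMarkovProc K P Wp w) (t : ℕ)
    {Z : Ω → S}
    (hZ : Measurable[⨆ s ∈ Finset.range (t + 1),
      MeasurableSpace.comap (Wp s) inferInstance] Z) :
    P.map (fun ω => ((Z ω, Wp t ω), Wp (t + 1) ω))
      = (P.map fun ω => (Z ω, Wp t ω)) ⊗ₘ K.comap (Prod.snd : S × Wsp dW → _) measurable_snd := by
  refine map_prodMk_eq_compProd_of_condExp (h.iSup_comap_le (t + 1)) (hZ.prodMk ?_)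
    (h.meas (t + 1)) (h.markov t)
  exact (comap_measurable (Wp t)).mono
    (le_iSup₂_of_le t (Finset.self_mem_range_succ t) le_rfl) le_rfl

lemma map_eq_kiter (h : IsMarkovProc K P Wp w) (t : ℕ) : P.map (Wp t) = kiter K t w := by
  induction t with
  | zero =>
    change _ = Kernel.id w
    rw [Kernel.id_apply, Measure.map_congr (g := fun _ => w) h.init, Measure.map_const]
    simp
  | succ t ih =>
    have hm := h.iSup_comap_le (t + 1)
    have hWt : Measurable[⨆ s ∈ Finset.range (t + 1),
        MeasurableSpace.comap (Wp s) inferInstance] (Wp t) :=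
      (comap_measurable (Wp t)).mono
        (le_iSup₂_of_le t (Finset.self_mem_range_succ t) le_rfl) le_rfl
    have hj := congrArg Measure.snd
      (map_prodMk_eq_compProd_of_condExp hm hWt (h.meas (t + 1)) (h.markov t))
    rw [Measure.snd_compProd, Measure.snd_map_prodMk (h.meas t), ih] at hj
    rw [hj, ← comp_kiter, Kernel.comp_apply]

lemma integral_eq_kiter (h : IsMarkovProc K P Wp w) (t : ℕ) {f : Wsp dW → ℝ}
    (hf : Measurable f) : ∫ ω, f (Wp t ω) ∂P = ∫ x, f x ∂(kiter K t w) := by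
  rw [← h.map_eq_kiter t, integral_map (h.meas t).aemeasurable hf.aestronglyMeasurable]

lemma integrable_of_integrable_kiter (h : IsMarkovProc K P Wp w) (t : ℕ) {f : Wsp dW → ℝ}
    (hf : Integrable f (kiter K t w)) : Integrable (fun ω => f (Wp t ω)) P :=
  Integrable.comp_measurable (by rwa [h.map_eq_kiter t]) (h.meas t)

lemma integral_integral_kernel {S : Type*} [MeasurableSpace S] (h : IsMarkovProc K P Wp w)
    (t : ℕ) {Z : Ω → S}
    (hZ : Measurable[⨆ s ∈ Finset.range (t + 1),
      MeasurableSpace.comap (Wp s) inferInstance] Z)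
    {u : S × Wsp dW → ℝ} (hu : Measurable u)
    (hint : Integrable (fun ω => u (Z ω, Wp (t + 1) ω)) P) :
    Integrable (fun ω => ∫ x, u (Z ω, x) ∂(K (Wp t ω))) P ∧
    ∫ ω, ∫ x, u (Z ω, x) ∂(K (Wp t ω)) ∂P = ∫ ω, u (Z ω, Wp (t + 1) ω) ∂P := by
  have hZ' : Measurable Z := hZ.mono (h.iSup_comap_le (t + 1)) le_rfl
  have hZW : Measurable fun ω => (Z ω, Wp t ω) := hZ'.prodMk (h.meas t)
  have hall : Measurable fun ω => ((Z ω, Wp t ω), Wp (t + 1) ω) := hZW.prodMk (h.meas _)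
  have := Measure.isProbabilityMeasure_map (μ := P) hZW.aemeasurable
  set v : (S × Wsp dW) × Wsp dW → ℝ := fun q => u (q.1.1, q.2)
  have hv : Measurable v := by fun_prop
  have hvint : Integrable v
      ((P.map fun ω => (Z ω, Wp t ω)) ⊗ₘ K.comap (Prod.snd : S × Wsp dW → _) measurable_snd) := by
    rw [← h.map_prodMk t hZ]
    exact (integrable_map_measure hv.aestronglyMeasurable hall.aemeasurable).2 hint
  have hi : Integrable (fun p : S × Wsp dW => ∫ x, v (p, x) ∂(K p.2))
      (P.map fun ω => (Z ω, Wp t ω)) := by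
    simpa using Integrable.integral_compProd hvint
  constructor
  · exact hi.comp_measurable hZW
  · have h1 := Measure.integral_compProd hvint
    simp only [Kernel.comap_apply] at h1
    rw [← h.map_prodMk t hZ, integral_map hall.aemeasurable hv.aestronglyMeasurable,
      integral_map hZW.aemeasurable
        hi.aestronglyMeasurable] at h1
    exact h1.symm

/-- Moments of the state are bounded uniformly in time. -/
lemma exists_integral_le {ν : Measure (Wsp dW)} [IsProbabilityMeasure ν] {c₁ ρ d : ℝ}
    (h : IsMarkovProc K P Wp w) (hU : UdBound K ν c₁ ρ d) (hc₁ : 0 < c₁) (hρ₀ : 0 ≤ ρ)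
    (hρ₁ : ρ < 1) :
    ∃ M, ∀ t, Integrable (fun ω => 1 + ‖Wp t ω‖ ^ d) P ∧ ∫ ω, (1 + ‖Wp t ω‖ ^ d) ∂P ≤ M := by
  refine ⟨∫ x, (1 + ‖x‖ ^ d) ∂ν + c₁ * (1 + ‖w‖ ^ d), fun t =>
    ⟨h.integrable_of_integrable_kiter t (hU.integrable_kiter t w), ?_⟩⟩
  rw [h.integral_eq_kiter t (f := fun x => 1 + ‖x‖ ^ d) (by fun_prop)]
  have h1 := (abs_le.1 (hU.abs_integral_sub_le t w (f := fun x => 1 + ‖x‖ ^ d) (by fun_prop)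
    fun x => (abs_of_nonneg (by positivity)).le)).2
  have h2 : c₁ * ρ ^ t * (1 + ‖w‖ ^ d) ≤ c₁ * 1 * (1 + ‖w‖ ^ d) := by
    gcongr
    exact pow_le_one₀ hρ₀ hρ₁.le
  linarith

end IsMarkovProc

section SlowIterate

variable {dW dX : ℕ} {Ω : Type*}
  {H : Wsp dW → EuclideanSpace ℝ (Fin dX) → EuclideanSpace ℝ (Fin dX)}
  {β : ℕ → ℝ} {B : ℝ} {Wp : ℕ → Ω → Wsp dW} {xi0 : EuclideanSpace ℝ (Fin dX)}

lemma xiSeq_succ (t : ℕ) (ω : Ω) :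
    xiSeq H β B Wp xi0 (t + 1) ω
      = projB B (xiSeq H β B Wp xi0 t ω + β t • H (Wp t ω) (xiSeq H β B Wp xi0 t ω)) := rfl

lemma norm_xiSeq_le (hB : 0 ≤ B) (hxi0 : ‖xi0‖ ≤ B) (t : ℕ) (ω : Ω) :
    ‖xiSeq H β B Wp xi0 t ω‖ ≤ B := by
  cases t with
  | zero => exact hxi0
  | succ t => exact norm_projB_le hB _

lemma measurable_xiSeq
    (hH : Measurable fun p : Wsp dW × EuclideanSpace ℝ (Fin dX) => H p.1 p.2) (t : ℕ) :
    Measurable[⨆ s ∈ Finset.range t, MeasurableSpace.comap (Wp s) inferInstance]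
      (xiSeq H β B Wp xi0 t) := by
  induction t with
  | zero => exact measurable_const
  | succ t ih =>
    set m := ⨆ s ∈ Finset.range (t + 1), MeasurableSpace.comap (Wp s) inferInstance
    have hξ : Measurable[m] (xiSeq H β B Wp xi0 t) :=
      ih.mono (biSup_mono fun s hs => Finset.range_subset_range.2 t.le_succ hs) le_rfl
    have hW : Measurable[m] (Wp t) := (comap_measurable (Wp t)).mono
      (le_iSup₂_of_le t (Finset.self_mem_range_succ t) le_rfl) le_rfl
    have hstep : Measurable fun p : Wsp dW × EuclideanSpace ℝ (Fin dX) =>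
        projB B (p.2 + β t • H p.1 p.2) :=
      (measurable_projB B).comp (measurable_snd.add (hH.const_smul (β t)))
    have hpair : Measurable[m] fun ω => (Wp t ω, xiSeq H β B Wp xi0 t ω) := hW.prodMk hξ
    have hcomp := hstep.comp hpair
    exact hcomp

/-- The centered drift of half the squared error, with the parameter projected onto the ball. -/
def centeredDrift (ν : Measure (Wsp dW))
    (H : Wsp dW → EuclideanSpace ℝ (Fin dX) → EuclideanSpace ℝ (Fin dX))
    (xiStar : EuclideanSpace ℝ (Fin dX)) (B : ℝ) (x : Wsp dW)
    (ξ : EuclideanSpace ℝ (Fin dX)) : ℝ :=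
  ⟪projB B ξ - xiStar, H x (projB B ξ) - ∫ y, H y (projB B ξ) ∂ν⟫

lemma centeredDrift_of_norm_le {ν : Measure (Wsp dW)} {xiStar ξ : EuclideanSpace ℝ (Fin dX)}
    (hξ : ‖ξ‖ ≤ B) (x : Wsp dW) :
    centeredDrift ν H xiStar B x ξ = ⟪ξ - xiStar, H x ξ - ∫ y, H y ξ ∂ν⟫ := by
  rw [centeredDrift, projB_of_norm_le hξ]

end SlowIterate

namespace Assumption2

variable {dW dL dX : ℕ} {ν : Measure (Wsp dW)}
  {G : Wsp dW → EuclideanSpace ℝ (Fin dL) → EuclideanSpace ℝ (Fin dX) →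
    EuclideanSpace ℝ (Fin dL)}
  {H : Wsp dW → EuclideanSpace ℝ (Fin dX) → EuclideanSpace ℝ (Fin dX)}
  {lamStar : EuclideanSpace ℝ (Fin dL)} {xiStar : EuclideanSpace ℝ (Fin dX)}
  {B L ζ ψ : ℝ}

lemma norm_xiStar_le (h : Assumption2 ν G H lamStar xiStar B L ζ ψ) : ‖xiStar‖ ≤ B :=
  (le_max_right _ _).trans h.hB.le

lemma nonneg_radius (h : Assumption2 ν G H lamStar xiStar B L ζ ψ) : 0 ≤ B :=
  (norm_nonneg _).trans h.norm_xiStar_le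

lemma measurable_section (h : Assumption2 ν G H lamStar xiStar B L ζ ψ)
    (ξ : EuclideanSpace ℝ (Fin dX)) : Measurable fun x => H x ξ :=
  h.hHmeas.comp (measurable_id.prodMk measurable_const)

lemma measurable_centeredDrift [SFinite ν] (h : Assumption2 ν G H lamStar xiStar B L ζ ψ) :
    Measurable (Function.uncurry (centeredDrift ν H xiStar B)) := by
  have hp : Measurable fun q : Wsp dW × EuclideanSpace ℝ (Fin dX) => projB B q.2 :=
    (measurable_projB B).comp measurable_snd
  have hbar : Measurable fun ξ : EuclideanSpace ℝ (Fin dX) => ∫ y, H y ξ ∂ν :=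
    (h.hHmeas.comp measurable_swap).stronglyMeasurable.integral_prod_right'.measurable
  have h1 : Measurable fun q : Wsp dW × EuclideanSpace ℝ (Fin dX) => projB B q.2 - xiStar :=
    hp.sub_const xiStar
  have hpair := measurable_fst.prodMk hp
  have h2 : Measurable fun q : Wsp dW × EuclideanSpace ℝ (Fin dX) => H q.1 (projB B q.2) :=
    h.hHmeas.comp hpair
  have h3 : Measurable fun q : Wsp dW × EuclideanSpace ℝ (Fin dX) =>
    ∫ y, H y (projB B q.2) ∂ν := hbar.comp hp
  exact h1.inner (h2.sub h3)

lemma integrable_section (h : Assumption2 ν G H lamStar xiStar B L ζ ψ)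
    (hν : Integrable (fun x : Wsp dW => 1 + ‖x‖) ν)
    {ξ : EuclideanSpace ℝ (Fin dX)} (hξ : ‖ξ‖ ≤ B) :
    Integrable (fun x => H x ξ) ν :=
  (hν.const_mul L).mono' (h.measurable_section ξ).aestronglyMeasurable
    (.of_forall fun x => h.hHgrow x ξ hξ)

lemma norm_centered_le (h : Assumption2 ν G H lamStar xiStar B L ζ ψ)
    (hν : Integrable (fun x : Wsp dW => 1 + ‖x‖) ν)
    {ξ : EuclideanSpace ℝ (Fin dX)} (hξ : ‖ξ‖ ≤ B) (x : Wsp dW) :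
    ‖H x ξ - ∫ y, H y ξ ∂ν‖ ≤ L * (1 + ∫ y, (1 + ‖y‖) ∂ν) * (1 + ‖x‖) := by
  have hI : 0 ≤ ∫ y, (1 + ‖y‖) ∂ν := integral_nonneg fun y => by positivity
  have h1 : ‖∫ y, H y ξ ∂ν‖ ≤ L * ∫ y, (1 + ‖y‖) ∂ν := by
    rw [← integral_const_mul]
    exact norm_integral_le_of_norm_le (hν.const_mul L) (.of_forall fun y => h.hHgrow y ξ hξ)
  have h2 : 0 ≤ L * (∫ y, (1 + ‖y‖) ∂ν) * ‖x‖ := by have := h.hL; positivity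
  calc _ ≤ ‖H x ξ‖ + ‖∫ y, H y ξ ∂ν‖ := norm_sub_le _ _
    _ ≤ L * (1 + ‖x‖) + L * ∫ y, (1 + ‖y‖) ∂ν := add_le_add (h.hHgrow x ξ hξ) h1
    _ ≤ _ := by linarith

lemma norm_centered_sub_le (h : Assumption2 ν G H lamStar xiStar B L ζ ψ)
    (hν : Integrable (fun x : Wsp dW => 1 + ‖x‖) ν)
    {ξ ξ' : EuclideanSpace ℝ (Fin dX)} (hξ : ‖ξ‖ ≤ B) (hξ' : ‖ξ'‖ ≤ B)
    (x : Wsp dW) :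
    ‖(H x ξ - ∫ y, H y ξ ∂ν) - (H x ξ' - ∫ y, H y ξ' ∂ν)‖
      ≤ L * (1 + ∫ y, (1 + ‖y‖) ∂ν) * (1 + ‖x‖) * ‖ξ - ξ'‖ := by
  have hI : 0 ≤ ∫ y, (1 + ‖y‖) ∂ν := integral_nonneg fun y => by positivity
  have h1 : ‖∫ y, H y ξ ∂ν - ∫ y, H y ξ' ∂ν‖ ≤ L * (∫ y, (1 + ‖y‖) ∂ν) * ‖ξ - ξ'‖ := by
    rw [← integral_sub (h.integrable_section hν hξ) (h.integrable_section hν hξ'),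
      ← integral_const_mul, ← integral_mul_const]
    exact norm_integral_le_of_norm_le ((hν.const_mul L).mul_const _)
      (.of_forall fun y => h.hHLip y ξ ξ' hξ hξ')
  have h2 : 0 ≤ L * (∫ y, (1 + ‖y‖) ∂ν) * ‖x‖ * ‖ξ - ξ'‖ := by have := h.hL; positivity
  rw [sub_sub_sub_comm]
  calc _ ≤ ‖H x ξ - H x ξ'‖ + ‖∫ y, H y ξ ∂ν - ∫ y, H y ξ' ∂ν‖ := norm_sub_le _ _
    _ ≤ L * (1 + ‖x‖) * ‖ξ - ξ'‖ + L * (∫ y, (1 + ‖y‖) ∂ν) * ‖ξ - ξ'‖ :=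
      add_le_add (h.hHLip x ξ ξ' hξ hξ') h1
    _ ≤ _ := by linarith

lemma norm_sub_xiStar_le (h : Assumption2 ν G H lamStar xiStar B L ζ ψ)
    {ξ : EuclideanSpace ℝ (Fin dX)} (hξ : ‖ξ‖ ≤ B) :
    ‖ξ - xiStar‖ ≤ 2 * B :=
  (norm_sub_le _ _).trans (by linarith [h.norm_xiStar_le])

lemma abs_centeredDrift_le (h : Assumption2 ν G H lamStar xiStar B L ζ ψ)
    (hν : Integrable (fun x : Wsp dW => 1 + ‖x‖) ν)
    (ξ : EuclideanSpace ℝ (Fin dX)) (x : Wsp dW) :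
    |centeredDrift ν H xiStar B x ξ|
      ≤ (1 + 2 * B) * (L * (1 + ∫ y, (1 + ‖y‖) ∂ν)) * (1 + ‖x‖) := by
  have hI : 0 ≤ ∫ y, (1 + ‖y‖) ∂ν := integral_nonneg fun y => by positivity
  have hB := h.nonneg_radius
  have hL := h.hL
  have hp := norm_projB_le hB ξ
  set D := L * (1 + ∫ y, (1 + ‖y‖) ∂ν)
  calc _ ≤ 2 * B * (D * (1 + ‖x‖)) :=
        (abs_real_inner_le_norm _ _).trans (mul_le_mul (h.norm_sub_xiStar_le hp)
          (h.norm_centered_le hν hp x) (norm_nonneg _) (by positivity))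
    _ ≤ (1 + 2 * B) * (D * (1 + ‖x‖)) := by gcongr; linarith
    _ = _ := by ring

lemma abs_centeredDrift_sub_le (h : Assumption2 ν G H lamStar xiStar B L ζ ψ)
    (hν : Integrable (fun x : Wsp dW => 1 + ‖x‖) ν)
    {ξ ξ' : EuclideanSpace ℝ (Fin dX)} (hξ : ‖ξ‖ ≤ B)
    (hξ' : ‖ξ'‖ ≤ B) (x : Wsp dW) :
    |centeredDrift ν H xiStar B x ξ - centeredDrift ν H xiStar B x ξ'|
      ≤ (1 + 2 * B) * (L * (1 + ∫ y, (1 + ‖y‖) ∂ν)) * ‖ξ - ξ'‖ * (1 + ‖x‖) := by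
  have hB := h.nonneg_radius
  have h1 := h.norm_centered_le hν hξ x
  have h2 := h.norm_centered_sub_le hν hξ hξ' x
  have h3 := h.norm_sub_xiStar_le hξ'
  rw [centeredDrift_of_norm_le hξ, centeredDrift_of_norm_le hξ']
  set D := L * (1 + ∫ y, (1 + ‖y‖) ∂ν)
  generalize H x ξ - ∫ y, H y ξ ∂ν = a at *
  generalize H x ξ' - ∫ y, H y ξ' ∂ν = a' at *
  have heq : ⟪ξ - xiStar, a⟫ - ⟪ξ' - xiStar, a'⟫ = ⟪ξ - ξ', a⟫ + ⟪ξ' - xiStar, a - a'⟫ := by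
    simp only [inner_sub_left, inner_sub_right]; ring
  rw [heq]
  calc _ ≤ ‖ξ - ξ'‖ * ‖a‖ + ‖ξ' - xiStar‖ * ‖a - a'‖ :=
        (abs_add_le _ _).trans
          (add_le_add (abs_real_inner_le_norm _ _) (abs_real_inner_le_norm _ _))
    _ ≤ ‖ξ - ξ'‖ * (D * (1 + ‖x‖)) + 2 * B * (D * (1 + ‖x‖) * ‖ξ - ξ'‖) := by gcongr
    _ = _ := by ring

lemma integral_centeredDrift [IsProbabilityMeasure ν]
    (h : Assumption2 ν G H lamStar xiStar B L ζ ψ)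
    (hν : Integrable (fun x : Wsp dW => 1 + ‖x‖) ν)
    (ξ : EuclideanSpace ℝ (Fin dX)) :
    ∫ x, centeredDrift ν H xiStar B x ξ ∂ν = 0 := by
  have hint := h.integrable_section hν (norm_projB_le h.nonneg_radius ξ)
  simp only [centeredDrift]
  have hs : Integrable (fun x => H x (projB B ξ) - ∫ y, H y (projB B ξ) ∂ν) ν :=
    hint.sub (integrable_const _)
  rw [integral_inner hs, integral_sub hint (integrable_const _)]
  simp

/-- The noise in the drift of the squared error solves a Poisson equation with a solution of
linear growth that is Lipschitz in the parameter. -/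
lemma exists_poisson [IsProbabilityMeasure ν]
    (h : Assumption2 ν G H lamStar xiStar B L ζ ψ)
    {K : Kernel (Wsp dW) (Wsp dW)} [IsMarkovKernel K]
    {c₁ ρ : ℝ} (hU : UdBound K ν c₁ ρ 1) (hc₁ : 0 < c₁) (hρ₀ : 0 ≤ ρ) (hρ₁ : ρ < 1) :
    ∃ C, 0 ≤ C ∧ ∃ u : EuclideanSpace ℝ (Fin dX) × Wsp dW → ℝ, Measurable u ∧
      (∀ ξ x, |u (ξ, x)| ≤ C * (1 + ‖x‖)) ∧
      (∀ ξ ξ' x, ‖ξ‖ ≤ B → ‖ξ'‖ ≤ B →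
        |u (ξ, x) - u (ξ', x)| ≤ C * ‖ξ - ξ'‖ * (1 + ‖x‖)) ∧
      ∀ ξ x, ‖ξ‖ ≤ B → ⟪ξ - xiStar, H x ξ - ∫ y, H y ξ ∂ν⟫
        = u (ξ, x) - ∫ y, u (ξ, y) ∂(K x) := by
  have hν : Integrable (fun x : Wsp dW => 1 + ‖x‖) ν := by simpa using hU.1
  have hI : 0 ≤ ∫ y, (1 + ‖y‖) ∂ν := integral_nonneg fun y => by positivity
  have hgm := h.measurable_centeredDrift
  have hgV := h.abs_centeredDrift_le hν
  have hgLip := fun ξ ξ' hξ hξ' => h.abs_centeredDrift_sub_le hν (ξ := ξ) (ξ' := ξ') hξ hξ'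
  have hgν := h.integral_centeredDrift hν
  have hC0 : 0 ≤ (1 + 2 * B) * (L * (1 + ∫ y, (1 + ‖y‖) ∂ν)) := by
    have := h.nonneg_radius
    have := h.hL
    positivity
  have hgb := fun ξ hξ x =>
    centeredDrift_of_norm_le (ν := ν) (H := H) (xiStar := xiStar) (B := B) (ξ := ξ) hξ x
  generalize (1 + 2 * B) * (L * (1 + ∫ y, (1 + ‖y‖) ∂ν)) = C at *
  generalize centeredDrift ν H xiStar B = g at *
  have hgx : ∀ ξ, Measurable fun x => g x ξ := fun ξ =>
    hgm.comp (measurable_id.prodMk measurable_const)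
  have hgV' : ∀ ξ x, |g x ξ| ≤ C * (1 + ‖x‖ ^ (1 : ℝ)) := by simpa using hgV
  have hE : 0 ≤ c₁ * (1 - ρ)⁻¹ := mul_nonneg hc₁.le (inv_nonneg.2 (by linarith))
  refine ⟨C * (c₁ * (1 - ρ)⁻¹), by positivity,
    fun p => poissonSol K (fun x => g x p.1) p.2,
    hU.measurable_poissonSol hρ₀ hρ₁ hC0 hgm hgV' hgν, fun ξ x => ?_, fun ξ ξ' x hξ hξ' => ?_,
    fun ξ x hξ => ?_⟩
  · simpa using hU.abs_poissonSol_le hρ₀ hρ₁ hC0 (hgx ξ) (hgV' ξ) (hgν ξ) x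
  · rw [← hU.poissonSol_sub hρ₀ hρ₁ hC0 (hgx ξ) (hgV' ξ) (hgν ξ) (hgx ξ') (hgV' ξ') (hgν ξ') x]
    have hint := fun ξ => hU.1.const_mul C |>.mono' (hgx ξ).aestronglyMeasurable
      (.of_forall (hgV' ξ))
    have := hU.abs_poissonSol_le hρ₀ hρ₁ (C := C * ‖ξ - ξ'‖) (by positivity)
      (g := fun x => g x ξ - g x ξ') ((hgx ξ).sub (hgx ξ'))
      (fun x => by simpa using hgLip ξ ξ' hξ hξ' x)
      (by rw [integral_sub (hint ξ) (hint ξ'), hgν, hgν, sub_zero]) x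
    rw [Real.rpow_one] at this
    exact this.trans_eq (by ring)
  · rw [← hgb ξ hξ x]
    have := hU.poissonSol_eq_add hρ₀ hρ₁ hC0 (hgx ξ) (hgV' ξ) (hgν ξ) x
    simp only
    linarith

end Assumption2

namespace Assumption2

variable {dW dL dX : ℕ} {ν : Measure (Wsp dW)}
  {G : Wsp dW → EuclideanSpace ℝ (Fin dL) → EuclideanSpace ℝ (Fin dX) →
    EuclideanSpace ℝ (Fin dL)}
  {H : Wsp dW → EuclideanSpace ℝ (Fin dX) → EuclideanSpace ℝ (Fin dX)}
  {lamStar : EuclideanSpace ℝ (Fin dL)} {xiStar : EuclideanSpace ℝ (Fin dX)}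
  {B L ζ ψ : ℝ}

/-- One projected step contracts the squared error up to the centered drift and a term of second
order in the step size. -/
lemma norm_projB_step_sub_sq_le (h : Assumption2 ν G H lamStar xiStar B L ζ ψ) {b : ℝ}
    (hb : 0 ≤ b) {ξ : EuclideanSpace ℝ (Fin dX)} (hξ : ‖ξ‖ ≤ B) (x : Wsp dW) :
    ‖projB B (ξ + b • H x ξ) - xiStar‖ ^ 2
      ≤ (1 - 2 * ψ * b) * ‖ξ - xiStar‖ ^ 2 + 2 * b * ⟪ξ - xiStar, H x ξ - ∫ y, H y ξ ∂ν⟫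
        + 2 * L ^ 2 * b ^ 2 * (1 + ‖x‖ ^ 2) := by
  have hmono := h.hHmono ξ
  rw [h.hHstar, sub_zero] at hmono
  have hgrow : ‖H x ξ‖ ^ 2 ≤ 2 * L ^ 2 * (1 + ‖x‖ ^ 2) :=
    calc ‖H x ξ‖ ^ 2 ≤ (L * (1 + ‖x‖)) ^ 2 := by gcongr; exact h.hHgrow x ξ hξ
      _ ≤ _ := by nlinarith [mul_nonneg (sq_nonneg L) (sq_nonneg (1 - ‖x‖))]
  have hexp : ‖ξ + b • H x ξ - xiStar‖ ^ 2
      = ‖ξ - xiStar‖ ^ 2 + 2 * b * ⟪ξ - xiStar, H x ξ⟫ + b ^ 2 * ‖H x ξ‖ ^ 2 := by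
    rw [add_sub_right_comm, norm_add_sq_real, inner_smul_right, norm_smul, Real.norm_eq_abs,
      mul_pow, sq_abs]
    ring
  have hproj : ‖projB B (ξ + b • H x ξ) - xiStar‖ ^ 2 ≤ ‖ξ + b • H x ξ - xiStar‖ ^ 2 := by
    gcongr
    exact norm_projB_sub_le h.norm_xiStar_le _
  rw [inner_sub_right]
  linarith [mul_le_mul_of_nonneg_left hmono (mul_nonneg zero_le_two hb),
    mul_le_mul_of_nonneg_left hgrow (sq_nonneg b)]

/-- The mean squared error of the slow iterate satisfies a contractive recursion perturbed by a
discounted telescoping term and a term of second order in the step size. -/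
lemma exists_recursion [IsProbabilityMeasure ν] (h : Assumption2 ν G H lamStar xiStar B L ζ ψ)
    {K : Kernel (Wsp dW) (Wsp dW)} [IsMarkovKernel K] {c₁ ρ : ℝ}
    (hU1 : UdBound K ν c₁ ρ 1) (hU2 : UdBound K ν c₁ ρ 2) (hc₁ : 0 < c₁) (hρ₀ : 0 ≤ ρ)
    (hρ₁ : ρ < 1) {Ω : Type*} [MeasurableSpace Ω] {P : Measure Ω} [IsProbabilityMeasure P]
    {Wp : ℕ → Ω → Wsp dW} {w : Wsp dW} (hMP : IsMarkovProc K P Wp w)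
    {xi0 : EuclideanSpace ℝ (Fin dX)} (hxi0 : ‖xi0‖ ≤ B) {β : ℕ → ℝ} (hβ : ∀ t, 0 ≤ β t) :
    ∃ A D, 0 ≤ A ∧ 0 ≤ D ∧ ∃ a : ℕ → ℝ, (∀ t, |a t| ≤ A) ∧
      ∀ t, ∫ ω, ‖xiSeq H β B Wp xi0 (t + 1) ω - xiStar‖ ^ 2 ∂P
        ≤ (1 - 2 * ψ * β t) * ∫ ω, ‖xiSeq H β B Wp xi0 t ω - xiStar‖ ^ 2 ∂P
          + 2 * β t * (a t - a (t + 1)) + D * β t ^ 2 := by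
  obtain ⟨C, hC, u, hum, hugrow, huLip, hueq⟩ := h.exists_poisson hU1 hc₁ hρ₀ hρ₁
  obtain ⟨M, hM⟩ := hMP.exists_integral_le hU2 hc₁ hρ₀ hρ₁
  simp only [Real.rpow_ofNat] at hM
  have hM0 : 0 ≤ M := (integral_nonneg fun ω => by positivity).trans (hM 0).2
  have hL := h.hL
  have hB := h.nonneg_radius
  set X := xiSeq H β B Wp xi0
  have hXB : ∀ t ω, ‖X t ω‖ ≤ B := norm_xiSeq_le hB hxi0
  have hXm : ∀ t, Measurable (X t) := fun t =>
    (measurable_xiSeq h.hHmeas t).mono (hMP.iSup_comap_le t) le_rfl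
  have hlin : ∀ r : ℝ, 1 + r ≤ 2 * (1 + r ^ 2) := fun r => by nlinarith [sq_nonneg (4 * r - 1)]
  have huV : ∀ ξ x, |u (ξ, x)| ≤ 2 * C * (1 + ‖x‖ ^ 2) := fun ξ x =>
    (hugrow ξ x).trans (by linarith [mul_le_mul_of_nonneg_left (hlin ‖x‖) hC])
  have huint : ∀ s t, Integrable (fun ω => u (X s ω, Wp t ω)) P := fun s t =>
    ((hM t).1.const_mul (2 * C)).mono'
      (hum.comp ((hXm s).prodMk (hMP.meas t))).aestronglyMeasurable
      (.of_forall fun ω => huV _ _)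
  have hEint : ∀ t, Integrable (fun ω => ‖X t ω - xiStar‖ ^ 2) P := fun t =>
    .of_bound (((hXm t).sub_const xiStar).norm.pow_const 2).aestronglyMeasurable ((2 * B) ^ 2)
      (.of_forall fun ω => by
        rw [Real.norm_of_nonneg (by positivity)]
        gcongr
        exact h.norm_sub_xiStar_le (hXB t ω))
  refine ⟨2 * C * M, 2 * L ^ 2 * M + 4 * C * L * M, by positivity, by positivity,
    fun t => ∫ ω, u (X t ω, Wp t ω) ∂P, fun t => ?_, fun t => ?_⟩
  · calc |∫ ω, u (X t ω, Wp t ω) ∂P| ≤ ∫ ω, 2 * C * (1 + ‖Wp t ω‖ ^ 2) ∂P :=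
          norm_integral_le_of_norm_le (f := fun ω => u (X t ω, Wp t ω))
            ((hM t).1.const_mul (2 * C)) (.of_forall fun ω => huV (X t ω) (Wp t ω))
      _ ≤ 2 * C * M := by
          rw [integral_const_mul]
          exact mul_le_mul_of_nonneg_left (hM t).2 (by positivity)
  · have hXm' : Measurable[⨆ s ∈ Finset.range (t + 1),
        MeasurableSpace.comap (Wp s) inferInstance] (X t) :=
      (measurable_xiSeq h.hHmeas t).mono
        (biSup_mono fun s hs => Finset.range_subset_range.2 t.le_succ hs) le_rfl
    obtain ⟨hKint, hKeq⟩ := hMP.integral_integral_kernel t hXm' hum (huint t (t + 1))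
    have hI1 : Integrable (fun ω => (1 - 2 * ψ * β t) * ‖X t ω - xiStar‖ ^ 2) P :=
      (hEint t).const_mul _
    have hI2 : Integrable (fun ω => 2 * β t *
        (u (X t ω, Wp t ω) - ∫ y, u (X t ω, y) ∂(K (Wp t ω)))) P :=
      ((huint t t).sub hKint).const_mul _
    have hI3 : Integrable (fun ω => 2 * L ^ 2 * β t ^ 2 * (1 + ‖Wp t ω‖ ^ 2)) P :=
      (hM t).1.const_mul _
    have hI12 : Integrable (fun ω => (1 - 2 * ψ * β t) * ‖X t ω - xiStar‖ ^ 2 + 2 * β t *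
        (u (X t ω, Wp t ω) - ∫ y, u (X t ω, y) ∂(K (Wp t ω)))) P := hI1.add hI2
    have hstep : ∫ ω, ‖X (t + 1) ω - xiStar‖ ^ 2 ∂P
        ≤ ∫ ω, ((1 - 2 * ψ * β t) * ‖X t ω - xiStar‖ ^ 2
          + 2 * β t * (u (X t ω, Wp t ω) - ∫ y, u (X t ω, y) ∂(K (Wp t ω)))
          + 2 * L ^ 2 * β t ^ 2 * (1 + ‖Wp t ω‖ ^ 2)) ∂P := by
      refine integral_mono (hEint _) (hI12.add hI3) fun ω => ?_
      have := h.norm_projB_step_sub_sq_le (hβ t) (hXB t ω) (Wp t ω)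
      rwa [hueq _ _ (hXB t ω)] at this
    rw [integral_add hI12 hI3, integral_add hI1 hI2, integral_const_mul, integral_const_mul,
      integral_const_mul, integral_sub (huint t t) hKint, hKeq] at hstep
    have hshift : ∫ ω, u (X (t + 1) ω, Wp (t + 1) ω) ∂P - ∫ ω, u (X t ω, Wp (t + 1) ω) ∂P
        ≤ C * L * β t * (M + M) := by
      rw [← integral_sub (huint _ _) (huint _ _)]
      calc _ ≤ ∫ ω, C * L * β t * ((1 + ‖Wp t ω‖ ^ 2) + (1 + ‖Wp (t + 1) ω‖ ^ 2)) ∂P := by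
            refine integral_mono ((huint _ _).sub (huint _ _))
              (((hM t).1.add (hM (t + 1)).1).const_mul _) fun ω => ?_
            have hinc : ‖X (t + 1) ω - X t ω‖ ≤ β t * (L * (1 + ‖Wp t ω‖)) := by
              rw [show X (t + 1) ω = projB B (X t ω + β t • H (Wp t ω) (X t ω)) from
                xiSeq_succ t ω]
              refine (norm_projB_sub_le (hXB t ω) _).trans ?_
              rw [add_sub_cancel_left, norm_smul, Real.norm_of_nonneg (hβ t)]
              exact mul_le_mul_of_nonneg_left (h.hHgrow _ _ (hXB t ω)) (hβ t)
            have hprod : (1 + ‖Wp t ω‖) * (1 + ‖Wp (t + 1) ω‖)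
                ≤ (1 + ‖Wp t ω‖ ^ 2) + (1 + ‖Wp (t + 1) ω‖ ^ 2) := by
              nlinarith [sq_nonneg (‖Wp t ω‖ - ‖Wp (t + 1) ω‖), sq_nonneg (1 - ‖Wp t ω‖),
                sq_nonneg (1 - ‖Wp (t + 1) ω‖)]
            calc _ ≤ C * ‖X (t + 1) ω - X t ω‖ * (1 + ‖Wp (t + 1) ω‖) :=
                  (le_abs_self _).trans (huLip _ _ _ (hXB _ _) (hXB _ _))
              _ ≤ C * (β t * (L * (1 + ‖Wp t ω‖))) * (1 + ‖Wp (t + 1) ω‖) := by gcongr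
              _ = C * L * β t * ((1 + ‖Wp t ω‖) * (1 + ‖Wp (t + 1) ω‖)) := by ring
              _ ≤ _ := mul_le_mul_of_nonneg_left hprod
                  (mul_nonneg (mul_nonneg hC hL.le) (hβ t))
        _ ≤ C * L * β t * (M + M) := by
            rw [integral_const_mul, integral_add (hM t).1 (hM (t + 1)).1]
            exact mul_le_mul_of_nonneg_left (add_le_add (hM t).2 (hM (t + 1)).2)
              (mul_nonneg (mul_nonneg hC hL.le) (hβ t))
    have h1 := mul_le_mul_of_nonneg_left (hM t).2
      (show 0 ≤ 2 * L ^ 2 * β t ^ 2 by positivity)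
    have h2 := mul_le_mul_of_nonneg_left hshift (mul_nonneg zero_le_two (hβ t))
    linarith

/-- The mean squared error of the slow iterate is of the order of the step size. -/
lemma exists_integral_norm_xiSeq_sub_sq_le [IsProbabilityMeasure ν]
    (h : Assumption2 ν G H lamStar xiStar B L ζ ψ)
    {K : Kernel (Wsp dW) (Wsp dW)} [IsMarkovKernel K] {c₁ ρ : ℝ}
    (hU1 : UdBound K ν c₁ ρ 1) (hU2 : UdBound K ν c₁ ρ 2) (hc₁ : 0 < c₁) (hρ₀ : 0 ≤ ρ)
    (hρ₁ : ρ < 1) {Ω : Type*} [MeasurableSpace Ω] {P : Measure Ω} [IsProbabilityMeasure P]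
    {Wp : ℕ → Ω → Wsp dW} {w : Wsp dW} (hMP : IsMarkovProc K P Wp w)
    {xi0 : EuclideanSpace ℝ (Fin dX)} (hxi0 : ‖xi0‖ ≤ B) {β₀ δ : ℝ} (hβ₀ : 0 < β₀)
    (hδ0 : 0 < δ) (hδ1 : δ ≤ 1) (hδone : δ = 1 → 1 < ψ * β₀) :
    ∃ k : ℝ, 0 < k ∧ ∃ T : ℕ, ∀ t : ℕ, T ≤ t →
      (∫ ω, ‖xiSeq H (fun s => β₀ * (s : ℝ) ^ (-δ)) B Wp xi0 t ω - xiStar‖ ^ 2 ∂P)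
        ≤ (t : ℝ) ^ (-δ) * k := by
  obtain ⟨A, D, hA, hD, a, ha, hrec⟩ := h.exists_recursion hU1 hU2 hc₁ hρ₀ hρ₁ hMP hxi0
    (β := fun s => β₀ * (s : ℝ) ^ (-δ)) fun t => by positivity
  set x : ℕ → ℝ := fun t =>
    ∫ ω, ‖xiSeq H (fun s => β₀ * (s : ℝ) ^ (-δ)) B Wp xi0 t ω - xiStar‖ ^ 2 ∂P
  have hψ := h.hψ
  obtain ⟨E, hE, hy⟩ := exists_le_rpow_neg_of_recursion (c := 2 * ψ * β₀)
    (C := (4 * ψ * A + D) * β₀ ^ 2 + 2 * A * β₀)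
    (y := fun t => x t + 2 * (β₀ * (t : ℝ) ^ (-δ)) * a t) hδ0 hδ1 (by positivity)
    (fun h1 => by linarith [hδone h1]) (by
      filter_upwards [eventually_ge_atTop 1] with t ht
      have ht0 : (0 : ℝ) < t := by exact_mod_cast ht
      have ht1 : (1 : ℝ) ≤ t := by exact_mod_cast ht
      have hr := hrec t
      have hr1 : (t : ℝ) ^ (-δ) - ((t : ℝ) + 1) ^ (-δ) ≤ ((t : ℝ) ^ (-δ)) ^ 2 := by
        have h1 := rpow_neg_mul_one_sub_inv_le hδ1 ht0
        have h2 : (t : ℝ)⁻¹ ≤ (t : ℝ) ^ (-δ) := by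
          rw [← Real.rpow_neg_one]
          exact Real.rpow_le_rpow_of_exponent_le ht1 (by linarith)
        have h3 := mul_le_mul_of_nonneg_left h2 (Real.rpow_nonneg ht0.le (-δ))
        linarith
      have hr0 : 0 ≤ (t : ℝ) ^ (-δ) - ((t : ℝ) + 1) ^ (-δ) :=
        sub_nonneg.2 (Real.rpow_le_rpow_of_nonpos ht0 (by linarith) (by linarith))
      push_cast
      set r := (t : ℝ) ^ (-δ)
      set r' := ((t : ℝ) + 1) ^ (-δ)
      have h1 : -a (t + 1) * (r - r') ≤ A * r ^ 2 :=
        (mul_le_mul_of_nonneg_right ((neg_le_abs _).trans (ha (t + 1))) hr0).trans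
          (mul_le_mul_of_nonneg_left hr1 hA)
      have h2 : a t * (ψ * β₀ ^ 2 * r ^ 2) ≤ A * (ψ * β₀ ^ 2 * r ^ 2) :=
        mul_le_mul_of_nonneg_right ((le_abs_self _).trans (ha t)) (by positivity)
      have h3 := mul_le_mul_of_nonneg_left h1 hβ₀.le
      change x (t + 1) ≤ (1 - 2 * ψ * (β₀ * r)) * x t + _ + _ at hr
      linarith)
  obtain ⟨T, hT⟩ := eventually_atTop.1 hy
  refine ⟨E + 2 * β₀ * A + 1, by positivity, T, fun t ht => ?_⟩
  have hr : 0 ≤ (t : ℝ) ^ (-δ) := by positivity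
  have h1 : -a t * (β₀ * (t : ℝ) ^ (-δ)) ≤ A * (β₀ * (t : ℝ) ^ (-δ)) :=
    mul_le_mul_of_nonneg_right ((neg_le_abs _).trans (ha t)) (by positivity)
  have h2 := hT t ht
  change x t ≤ _
  linarith

end Assumption2

/-- Proposition 1(ii): finite-time risk bound for the slow iterate. -/
theorem proposition1_ii
    {dW dL dX : ℕ} {Ω : Type*} [MeasurableSpace Ω]
    (K : Kernel (Wsp dW) (Wsp dW)) [IsMarkovKernel K]
    (ν : Measure (Wsp dW)) [IsProbabilityMeasure ν]
    (hstat : ν.bind (⇑K) = ν)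
    (c₁ ρ : ℝ) (hc₁ : 0 < c₁) (hρ₀ : 0 ≤ ρ) (hρ₁ : ρ < 1)
    (hU1 : UdBound K ν c₁ ρ 1) (hU2 : UdBound K ν c₁ ρ 2)
    (G : Wsp dW → EuclideanSpace ℝ (Fin dL) → EuclideanSpace ℝ (Fin dX) →
      EuclideanSpace ℝ (Fin dL))
    (H : Wsp dW → EuclideanSpace ℝ (Fin dX) → EuclideanSpace ℝ (Fin dX))
    (lamStar : EuclideanSpace ℝ (Fin dL)) (xiStar : EuclideanSpace ℝ (Fin dX))
    (B L ζ ψ : ℝ)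
    (hA2 : Assumption2 ν G H lamStar xiStar B L ζ ψ)
    (α₀ β₀ κ δ : ℝ) (hα₀ : 0 < α₀) (hβ₀ : 0 < β₀)
    (hκpos : 0 < κ) (hκδ : κ ≤ δ) (hδ1 : δ ≤ 1)
    (hκone : κ = 1 → 1 < ζ * α₀) (hδone : δ = 1 → 1 < ψ * β₀)
    (P : Measure Ω) [IsProbabilityMeasure P]
    (Wp : ℕ → Ω → Wsp dW) (w : Wsp dW)
    (hMP : IsMarkovProc K P Wp w)
    (lam0 : EuclideanSpace ℝ (Fin dL)) (xi0 : EuclideanSpace ℝ (Fin dX))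
    (hlam0 : ‖lam0‖ ≤ B) (hxi0 : ‖xi0‖ ≤ B) :
    (∃ k₁ k₂ : ℝ, 0 ≤ k₁ ∧ 0 < k₂ ∧ ∃ T : ℕ, ∀ t : ℕ, T ≤ t →
        (∫ ω, ‖xiSeq H (fun s => β₀ * (s : ℝ) ^ (-δ)) B Wp xi0 t ω - xiStar‖ ^ 2 ∂P)
          ≤ (t : ℝ) ^ (-δ) * (k₁ * Real.log t + k₂)) ∧
    ((∀ w', K w' = ν) →
      ∃ k₂ : ℝ, 0 < k₂ ∧ ∃ T : ℕ, ∀ t : ℕ, T ≤ t →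
        (∫ ω, ‖xiSeq H (fun s => β₀ * (s : ℝ) ^ (-δ)) B Wp xi0 t ω - xiStar‖ ^ 2 ∂P)
          ≤ (t : ℝ) ^ (-δ) * k₂) := by
  obtain ⟨k, hk, T, hT⟩ := hA2.exists_integral_norm_xiSeq_sub_sq_le hU1 hU2 hc₁ hρ₀ hρ₁ hMP hxi0
    hβ₀ (hκpos.trans_le hκδ) hδ1 hδone
  exact ⟨⟨0, k, le_rfl, hk, T, by simpa using hT⟩, fun _ => ⟨k, hk, T, hT⟩⟩

end
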